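/- Let A, B, C be odd positive integers with gcd(A, C) = 1 and gcd(A·C, B) = 1. Then the Diophantine equation x^{2A} + y^{2B} = z^{2C} has infinitely many solutions in positive integers x, y, z. -/

import Mathlib

lemma Nat.Coprime.exists_mul_add_one_eq_mul {m n : ℕ} (h : Nat.Coprime m n) (hn : 0 < n) :
    ∃ a b : ℕ, m * a + 1 = n * b := by
  obtain ⟨k, hm, hk⟩ := Nat.chineseRemainder h 0 (n - 1)
  obtain ⟨a, rfl⟩ := (Nat.modEq_zero_iff_dvd).1 hm
  have h1 : m * a + 1 ≡ 0 [MOD n] := by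
    have h2 := hk.add_right 1
    rw [Nat.sub_add_cancel hn] at h2
    exact h2.trans (Nat.modEq_zero_iff_dvd.2 dvd_rfl)
  obtain ⟨b, hb⟩ := Nat.modEq_zero_iff_dvd.1 h1
  exact ⟨a, b, hb⟩

/-- Multiplying the triple `(3, 4, 5)` by a suitable `3 ^ u * 4 ^ v * 5 ^ w` turns its entries
into an `A`-th, a `B`-th and a `C`-th power. -/
lemma exists_pos_pow_add_pow_eq_pow {A B C : ℕ} (hA : 0 < A) (hB : 0 < B) (hC : 0 < C)
    (hAB : Nat.Coprime A B) (hAC : Nat.Coprime A C) (hBC : Nat.Coprime B C) :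
    ∃ x y z : ℕ, 0 < x ∧ 0 < y ∧ 0 < z ∧ x ^ (2 * A) + y ^ (2 * B) = z ^ (2 * C) := by
  obtain ⟨a₁, b₁, h₁⟩ := (hAB.symm.mul_left hAC.symm).exists_mul_add_one_eq_mul hA
  obtain ⟨a₂, b₂, h₂⟩ := (hAB.mul_left hBC.symm).exists_mul_add_one_eq_mul hB
  obtain ⟨a₃, b₃, h₃⟩ := (hAC.mul_left hBC).exists_mul_add_one_eq_mul hC
  refine ⟨3 ^ b₁ * 4 ^ (C * a₂) * 5 ^ (B * a₃), 3 ^ (C * a₁) * 4 ^ b₂ * 5 ^ (A * a₃),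
    3 ^ (B * a₁) * 4 ^ (A * a₂) * 5 ^ b₃, by positivity, by positivity, by positivity, ?_⟩
  have hx : (3 ^ b₁ * 4 ^ (C * a₂) * 5 ^ (B * a₃)) ^ A =
      3 ^ (B * C * a₁ + 1) * 4 ^ (A * C * a₂) * 5 ^ (A * B * a₃) := by
    rw [h₁]; simp only [mul_pow, ← pow_mul]; ring_nf
  have hy : (3 ^ (C * a₁) * 4 ^ b₂ * 5 ^ (A * a₃)) ^ B =
      3 ^ (B * C * a₁) * 4 ^ (A * C * a₂ + 1) * 5 ^ (A * B * a₃) := by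
    rw [h₂]; simp only [mul_pow, ← pow_mul]; ring_nf
  have hz : (3 ^ (B * a₁) * 4 ^ (A * a₂) * 5 ^ b₃) ^ C =
      3 ^ (B * C * a₁) * 4 ^ (A * C * a₂) * 5 ^ (A * B * a₃ + 1) := by
    rw [h₃]; simp only [mul_pow, ← pow_mul]; ring_nf
  rw [pow_mul' _ 2 A, pow_mul' _ 2 B, pow_mul' _ 2 C, hx, hy, hz]
  simp only [pow_succ _ (B * C * a₁), pow_succ _ (A * C * a₂), pow_succ _ (A * B * a₃)]
  generalize 3 ^ (B * C * a₁) = p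
  generalize 4 ^ (A * C * a₂) = q
  generalize 5 ^ (A * B * a₃) = r
  ring


/-- For odd positive integers `A, B, C` with `gcd(A, C) = 1` and
`gcd(A·C, B) = 1`, the equation `x^{2A} + y^{2B} = z^{2C}` has infinitely many
solutions in positive integers. -/
theorem stmt8 (A B C : ℕ) (hApos : 0 < A) (hBpos : 0 < B) (hCpos : 0 < C)
    (hA : Odd A) (hB : Odd B) (hC : Odd C)
    (hAC : Nat.Coprime A C) (hACB : Nat.Coprime (A * C) B) :
    {p : ℕ × ℕ × ℕ | 0 < p.1 ∧ 0 < p.2.1 ∧ 0 < p.2.2 ∧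
      p.1 ^ (2 * A) + p.2.1 ^ (2 * B) = p.2.2 ^ (2 * C)}.Infinite := by
  obtain ⟨x, y, z, hx, hy, hz, h⟩ := exists_pos_pow_add_pow_eq_pow hApos hBpos hCpos
    hACB.coprime_mul_right hAC hACB.coprime_mul_left.symm
  refine Set.infinite_of_injective_forall_mem
    (f := fun t : ℕ => (x * (t + 1) ^ (B * C), y * (t + 1) ^ (A * C), z * (t + 1) ^ (A * B)))
    (fun s t hst => ?_) (fun t => ⟨by positivity, by positivity, by positivity, ?_⟩)
  · have h1 := Nat.eq_of_mul_eq_mul_left hx (Prod.ext_iff.1 hst).1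
    exact Nat.succ_injective (Nat.pow_left_injective (Nat.mul_pos hBpos hCpos).ne' h1)
  · have hxt : (x * (t + 1) ^ (B * C)) ^ (2 * A) = x ^ (2 * A) * (t + 1) ^ (2 * A * B * C) := by
      rw [mul_pow, ← pow_mul]; congr 2; ring
    have hyt : (y * (t + 1) ^ (A * C)) ^ (2 * B) = y ^ (2 * B) * (t + 1) ^ (2 * A * B * C) := by
      rw [mul_pow, ← pow_mul]; congr 2; ring
    have hzt : (z * (t + 1) ^ (A * B)) ^ (2 * C) = z ^ (2 * C) * (t + 1) ^ (2 * A * B * C) := by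
      rw [mul_pow, ← pow_mul]; congr 2; ring
    change (x * (t + 1) ^ (B * C)) ^ (2 * A) + (y * (t + 1) ^ (A * C)) ^ (2 * B) =
      (z * (t + 1) ^ (A * B)) ^ (2 * C)
    rw [hxt, hyt, hzt, ← add_mul, h]
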